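/- arXiv:2409.06839 — 2 statements merged into one kernel-verified Lean document; each statement's English description precedes it below -/
import Mathlib

section
/- (Lemma 2, boundary condition for threshold-constrained indirect scalar quantization.) Let f : ℝ × ℝ → ℝ be a nonnegative measurable joint density with (s,x) ↦ (1+s²)f(s,x) integrable, x ↦ f(s,x) continuous for each s, and locally dominated as in the Leibniz rule hypotheses. Suppose the thresholds −∞ = t₀ < t₁ < … < t_{L−1} < t_L = ∞ and reconstruction values ŝ₁,…,ŝ_L minimize MSE = Σ_{ℓ=1}^{L} ∫_ℝ ∫_{t_{ℓ−1}}^{t_ℓ} (s − ŝ_ℓ)² f(s,x) dx ds (in particular each t_ℓ is a stationary point of the MSE). If for some ℓ ∈ {1,…,L−1} we have ŝ_ℓ ≠ ŝ_{ℓ+1} and f_X(t_ℓ) := ∫_ℝ f(s,t_ℓ) ds > 0, then (ŝ_ℓ + ŝ_{ℓ+1})/2 = g(t_ℓ), where g(t) := (∫_ℝ s f(s,t) ds) / (∫_ℝ f(s,t) ds) is the conditional mean of S given X = t. -/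
open MeasureTheory

/-- The quantization cell numbered `j ∈ {1,…,L}` determined by thresholds
`t 1 < … < t (L-1)` (with `t 0 = −∞` and `t L = +∞` understood). -/
def cell (L : ℕ) (t : ℕ → ℝ) (j : ℕ) : Set ℝ :=
  {x : ℝ | (1 < j → t (j - 1) < x) ∧ (j < L → x ≤ t j)}

lemma sq_sub_le_mul_one_add_sq (s c : ℝ) : (s - c) ^ 2 ≤ 2 * (1 + c ^ 2) * (1 + s ^ 2) := by
  nlinarith [sq_nonneg (s + c), mul_nonneg (sq_nonneg s) (sq_nonneg c)]

lemma integrable_sq_mul_of_integrable_one_add_sq {f : ℝ → ℝ → ℝ}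
    (hf_meas : Measurable (Function.uncurry f)) (hf_nonneg : ∀ s x, 0 ≤ f s x)
    (hf_int : Integrable (fun p : ℝ × ℝ => (1 + p.1 ^ 2) * f p.1 p.2)) (c : ℝ) :
    Integrable (fun p : ℝ × ℝ => (p.1 - c) ^ 2 * f p.1 p.2) := by
  have hm : Measurable fun p : ℝ × ℝ => f p.1 p.2 := hf_meas
  refine (hf_int.const_mul (2 * (1 + c ^ 2))).mono' (by fun_prop) (.of_forall fun p => ?_)
  rw [Real.norm_of_nonneg (mul_nonneg (sq_nonneg _) (hf_nonneg _ _)), ← mul_assoc]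
  exact mul_le_mul_of_nonneg_right (sq_sub_le_mul_one_add_sq _ _) (hf_nonneg _ _)

lemma integrable_mul_setIntegral {g : ℝ → ℝ} {f : ℝ → ℝ → ℝ}
    (h : Integrable (fun p : ℝ × ℝ => g p.1 * f p.1 p.2)) (C : Set ℝ) :
    Integrable (fun s => g s * ∫ x in C, f s x) := by
  have h' := h.integrableOn (s := Set.univ ×ˢ C)
  rw [IntegrableOn, Measure.volume_eq_prod, ← Measure.prod_restrict, Measure.restrict_univ] at h'
  simpa only [integral_const_mul] using h'.integral_prod_left

lemma ae_integrable_of_integrable_one_add_sq {f : ℝ → ℝ → ℝ}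
    (hf_int : Integrable (fun p : ℝ × ℝ => (1 + p.1 ^ 2) * f p.1 p.2)) :
    ∀ᵐ s, Integrable (f s) := by
  filter_upwards [hf_int.prod_right_ae] with s hs
  refine (hs.const_mul (1 + s ^ 2)⁻¹).congr (.of_forall fun x => ?_)
  exact inv_mul_cancel_left₀ (by positivity : 1 + s ^ 2 ≠ 0) (f s x)

lemma setIntegral_inter_Iic_sub {φ : ℝ → ℝ} (hφ : Integrable φ) {A : Set ℝ} {a b : ℝ}
    (hA : Set.uIoc a b ⊆ A) :
    (∫ x in A ∩ Set.Iic b, φ x) - ∫ x in A ∩ Set.Iic a, φ x = ∫ x in a..b, φ x := by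
  have h := intervalIntegral.integral_Iic_sub_Iic (μ := volume.restrict A) (a := a) (b := b)
    (hφ.restrict.integrableOn) (hφ.restrict.integrableOn)
  rw [Measure.restrict_restrict measurableSet_Iic, Measure.restrict_restrict measurableSet_Iic,
    intervalIntegral.intervalIntegral_eq_integral_uIoc, Measure.restrict_restrict
    measurableSet_uIoc, Set.inter_eq_left.2 hA,
    ← intervalIntegral.intervalIntegral_eq_integral_uIoc] at h
  rwa [Set.inter_comm A, Set.inter_comm A]

lemma setIntegral_inter_Ioi_sub {φ : ℝ → ℝ} (hφ : Integrable φ) {B : Set ℝ} {a b : ℝ}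
    (hB : Set.uIoc a b ⊆ B) :
    (∫ x in B ∩ Set.Ioi b, φ x) - ∫ x in B ∩ Set.Ioi a, φ x = -∫ x in a..b, φ x := by
  have split (c : ℝ) : (∫ x in B ∩ Set.Iic c, φ x) + ∫ x in B ∩ Set.Ioi c, φ x =
      ∫ x in B, φ x := by
    rw [← Set.compl_Iic, ← Set.sdiff_eq]
    exact integral_inter_add_sdiff measurableSet_Iic hφ.integrableOn
  linarith [split a, split b, setIntegral_inter_Iic_sub hφ hB]

lemma cell_eq_inter_Iic {L ℓ : ℕ} (hℓ : ℓ < L) (t : ℕ → ℝ) :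
    cell L t ℓ = {x | 1 < ℓ → t (ℓ - 1) < x} ∩ Set.Iic (t ℓ) := by
  ext x
  simp [cell, hℓ]

lemma cell_succ_eq_inter_Ioi {L ℓ : ℕ} (hℓ : 1 ≤ ℓ) (t : ℕ → ℝ) :
    cell L t (ℓ + 1) = {x | ℓ + 1 < L → x ≤ t (ℓ + 1)} ∩ Set.Ioi (t ℓ) := by
  ext x
  simp [cell, Nat.lt_of_succ_le hℓ, and_comm]

lemma cell_update_of_ne {L ℓ j : ℕ} (hj : 1 ≤ j) (h : j ≠ ℓ) (h' : j ≠ ℓ + 1) (t : ℕ → ℝ) (u : ℝ) :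
    cell L (Function.update t ℓ u) j = cell L t j := by
  have h'' : j - 1 ≠ ℓ := by omega
  simp [cell, Function.update_of_ne h, Function.update_of_ne h'']

/-- Moving the threshold `t ℓ` to `u` transfers the mass over `(t ℓ, u]` from cell `ℓ + 1` to
cell `ℓ`. -/
lemma sum_update_sub_sum {L ℓ : ℕ} {f : ℝ → ℝ → ℝ}
    (hf_meas : Measurable (Function.uncurry f)) (hf_nonneg : ∀ s x, 0 ≤ f s x)
    (hf_int : Integrable (fun p : ℝ × ℝ => (1 + p.1 ^ 2) * f p.1 p.2))
    (shat t : ℕ → ℝ) {u : ℝ} (hℓ : 1 ≤ ℓ) (hℓL : ℓ < L)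
    (hlo : 1 < ℓ → t (ℓ - 1) < t ℓ ∧ t (ℓ - 1) < u)
    (hhi : ℓ + 1 < L → t ℓ < t (ℓ + 1) ∧ u < t (ℓ + 1)) :
    (∑ j ∈ Finset.Icc 1 L, ∫ s, (s - shat j) ^ 2 *
        ∫ x in cell L (Function.update t ℓ u) j, f s x) -
      ∑ j ∈ Finset.Icc 1 L, ∫ s, (s - shat j) ^ 2 * ∫ x in cell L t j, f s x =
    ∫ s, ((s - shat ℓ) ^ 2 - (s - shat (ℓ + 1)) ^ 2) * ∫ x in (t ℓ)..u, f s x := by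
  have hsq_int (c : ℝ) (C : Set ℝ) : Integrable fun s => (s - c) ^ 2 * ∫ x in C, f s x :=
    integrable_mul_setIntegral (g := fun s => (s - c) ^ 2)
      (integrable_sq_mul_of_integrable_one_add_sq hf_meas hf_nonneg hf_int c) C
  rw [← Finset.sum_sub_distrib, Finset.sum_eq_add_of_mem ℓ (ℓ + 1)
    (Finset.mem_Icc.2 ⟨hℓ, hℓL.le⟩) (Finset.mem_Icc.2 ⟨by omega, hℓL⟩) (by omega)
    (fun j hj hne => by
      rw [cell_update_of_ne (Finset.mem_Icc.1 hj).1 hne.1 hne.2, sub_self]),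
    ← integral_sub (hsq_int _ _) (hsq_int _ _), ← integral_sub (hsq_int _ _) (hsq_int _ _),
    ← integral_add (by exact (hsq_int _ _).sub (hsq_int _ _)) (by exact (hsq_int _ _).sub (hsq_int _ _))]
  refine integral_congr_ae ?_
  filter_upwards [ae_integrable_of_integrable_one_add_sq hf_int] with s hs
  have hA : Set.uIoc (t ℓ) u ⊆ {x | 1 < ℓ → t (ℓ - 1) < x} := fun x hx h =>
    (lt_min (hlo h).1 (hlo h).2).trans hx.1
  have hB : Set.uIoc (t ℓ) u ⊆ {x | ℓ + 1 < L → x ≤ t (ℓ + 1)} := fun x hx h =>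
    hx.2.trans (max_lt (hhi h).1 (hhi h).2).le
  have h₁ := setIntegral_inter_Iic_sub hs hA
  have h₂ := setIntegral_inter_Ioi_sub hs hB
  have hpred : ℓ - 1 ≠ ℓ := by omega
  simp only [cell_eq_inter_Iic hℓL, cell_succ_eq_inter_Ioi hℓ, Function.update_self,
    Function.update_of_ne hpred, Function.update_of_ne (Nat.succ_ne_self ℓ)]
  linear_combination (s - shat ℓ) ^ 2 * h₁ + (s - shat (ℓ + 1)) ^ 2 * h₂

/-- The Leibniz rule for a weighted integral of `f` over a strip with a moving end. -/
lemma hasDerivAt_integral_mul_intervalIntegral {f : ℝ → ℝ → ℝ}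
    (hf_meas : Measurable (Function.uncurry f)) (hf_nonneg : ∀ s x, 0 ≤ f s x)
    (hcont : ∀ s, Continuous (f s)) {w M : ℝ → ℝ} (hw : Measurable w) {a ε : ℝ} (hε : 0 < ε)
    (hM : Integrable fun s => |w s| * M s) (hfM : ∀ s x, |x - a| < ε → f s x ≤ M s) :
    HasDerivAt (fun u => ∫ s, w s * ∫ x in a..u, f s x) (∫ s, w s * f s a) a := by
  have hmeas (u : ℝ) : Measurable fun s => f s u := hf_meas.comp measurable_prodMk_right
  have hmeas_int (C : Set ℝ) : Measurable fun s => ∫ x in C, f s x :=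
    (hf_meas.stronglyMeasurable.integral_prod_right (ν := volume.restrict C)).measurable
  refine (hasDerivAt_integral_of_dominated_loc_of_deriv_le (μ := volume)
    (F := fun u s => w s * ∫ x in a..u, f s x) (F' := fun u s => w s * f s u)
    (bound := fun s => |w s| * M s) (Metric.ball_mem_nhds a hε)
    (.of_forall fun u => ?_) (by simp) (hw.mul (hmeas a)).aestronglyMeasurable
    (.of_forall fun s u hu => ?_) hM (.of_forall fun s u _ => ?_)).2
  · simp only [intervalIntegral]
    exact (hw.mul ((hmeas_int _).sub (hmeas_int _))).aestronglyMeasurable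
  · rw [norm_mul, Real.norm_eq_abs, Real.norm_of_nonneg (hf_nonneg _ _)]
    exact mul_le_mul_of_nonneg_left (hfM s u hu) (abs_nonneg _)
  · exact ((hcont s).integral_hasStrictDerivAt a u).hasDerivAt.const_mul (w s)

lemma strictMono_update_threshold {L ℓ : ℕ} {t : ℕ → ℝ} {u : ℝ}
    (ht : ∀ i j : ℕ, 1 ≤ i → i < j → j ≤ L - 1 → t i < t j)
    (hlo : 1 < ℓ → t (ℓ - 1) < u) (hhi : ℓ + 1 < L → u < t (ℓ + 1))
    (i j : ℕ) (hi : 1 ≤ i) (hij : i < j) (hj : j ≤ L - 1) :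
    Function.update t ℓ u i < Function.update t ℓ u j := by
  rcases eq_or_ne i ℓ with rfl | hiℓ
  · rw [Function.update_self, Function.update_of_ne hij.ne']
    refine (hhi (by omega)).trans_le ?_
    rcases eq_or_lt_of_le (Nat.succ_le_of_lt hij) with h | h
    · exact (congrArg t h).le
    · exact (ht _ _ (by omega) h hj).le
  rw [Function.update_of_ne hiℓ]
  rcases eq_or_ne j ℓ with rfl | hjℓ
  · rw [Function.update_self]
    refine lt_of_le_of_lt ?_ (hlo (by omega))
    rcases eq_or_lt_of_le (Nat.le_sub_one_of_lt hij) with h | h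
    · exact (congrArg t h).le
    · exact (ht _ _ hi h (by omega)).le
  · rw [Function.update_of_ne hjℓ]
    exact ht i j hi hij hj

/-- **Lemma 2: boundary condition for threshold-constrained indirect scalar
quantization.**  Let `f` be a nonnegative measurable joint density with `(1+s²)f(s,x)`
integrable, `x ↦ f(s,x)` continuous for each `s`, and locally dominated near each threshold.
Suppose the thresholds `−∞ = t₀ < t₁ < … < t_{L−1} < t_L = ∞` and reconstruction values
`ŝ₁,…,ŝ_L` minimize `MSE = Σ_{j=1}^{L} ∫_ℝ ∫_{t_{j−1}}^{t_j} (s − ŝ_j)² f(s,x) dx ds`.  If for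
some `ℓ ∈ {1,…,L−1}` we have `ŝ_ℓ ≠ ŝ_{ℓ+1}` and `f_X(t_ℓ) = ∫_ℝ f(s,t_ℓ) ds > 0`, then
`(ŝ_ℓ + ŝ_{ℓ+1})/2 = g(t_ℓ)` where `g(t) = (∫_ℝ s f(s,t) ds)/(∫_ℝ f(s,t) ds)`. -/
theorem stmt_10 (L : ℕ) (hL : 2 ≤ L) (f : ℝ → ℝ → ℝ)
    (hf_meas : Measurable (Function.uncurry f))
    (hf_nonneg : ∀ s x, 0 ≤ f s x)
    (hf_int : Integrable (fun p : ℝ × ℝ => (1 + p.1 ^ 2) * f p.1 p.2))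
    (hcont : ∀ s, Continuous (f s))
    (shat : ℕ → ℝ) (t : ℕ → ℝ)
    (ht : ∀ i j : ℕ, 1 ≤ i → i < j → j ≤ L - 1 → t i < t j)
    (hdom : ∀ j : ℕ, 1 ≤ j → j ≤ L - 1 → ∃ ε > (0 : ℝ), ∃ M : ℝ → ℝ,
      Integrable (fun s => (1 + s ^ 2) * M s) ∧
      ∀ s x, |x - t j| < ε → f s x ≤ M s)
    (hmin : ∀ (t' : ℕ → ℝ), (∀ i j : ℕ, 1 ≤ i → i < j → j ≤ L - 1 → t' i < t' j) →
      ∀ shat' : ℕ → ℝ,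
      (∑ j ∈ Finset.Icc 1 L, ∫ s, (s - shat j) ^ 2 * ∫ x in cell L t j, f s x)
        ≤ ∑ j ∈ Finset.Icc 1 L, ∫ s, (s - shat' j) ^ 2 * ∫ x in cell L t' j, f s x)
    (ℓ : ℕ) (hℓ1 : 1 ≤ ℓ) (hℓ2 : ℓ ≤ L - 1)
    (hne : shat ℓ ≠ shat (ℓ + 1))
    (hfX : 0 < ∫ s, f s (t ℓ)) :
    (shat ℓ + shat (ℓ + 1)) / 2 = (∫ s, s * f s (t ℓ)) / (∫ s, f s (t ℓ)) := by
  obtain ⟨ε, hε, M, hM, hfM⟩ := hdom ℓ hℓ1 hℓ2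
  have hM_nonneg (s : ℝ) : 0 ≤ M s := (hf_nonneg s (t ℓ)).trans (hfM s (t ℓ) (by simpa using hε))
  have hf_le (s : ℝ) : f s (t ℓ) ≤ M s := hfM s (t ℓ) (by simpa using hε)
  have hMm : AEStronglyMeasurable M := by
    refine AEStronglyMeasurable.congr (f := fun s => (1 + s ^ 2)⁻¹ * ((1 + s ^ 2) * M s))
      (AEStronglyMeasurable.mul (by fun_prop) hM.aestronglyMeasurable) (.of_forall fun s => ?_)
    have : (1 + s ^ 2) ≠ 0 := by positivity
    field_simp
  have hmeas : Measurable fun s => f s (t ℓ) := hf_meas.comp measurable_prodMk_right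
  have hf0 : Integrable fun s => f s (t ℓ) := by
    refine hM.mono' hmeas.aestronglyMeasurable (.of_forall fun s => ?_)
    rw [Real.norm_of_nonneg (hf_nonneg _ _)]
    nlinarith [hf_le s, mul_nonneg (sq_nonneg s) (hM_nonneg s)]
  have hf1 : Integrable fun s => s * f s (t ℓ) := by
    refine hM.mono' (by fun_prop) (.of_forall fun s => ?_)
    rw [norm_mul, Real.norm_of_nonneg (hf_nonneg _ _), Real.norm_eq_abs]
    refine mul_le_mul ?_ (hf_le s) (hf_nonneg _ _) (by positivity)
    nlinarith [sq_abs s, sq_nonneg (|s| - 1)]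
  have hwM : Integrable fun s =>
      |(s - shat ℓ) ^ 2 - (s - shat (ℓ + 1)) ^ 2| * M s := by
    refine (hM.const_mul (2 * (1 + shat ℓ ^ 2) + 2 * (1 + shat (ℓ + 1) ^ 2))).mono'
      (AEStronglyMeasurable.mul (by fun_prop) hMm) (.of_forall fun s => ?_)
    rw [norm_mul, Real.norm_of_nonneg (hM_nonneg s), Real.norm_eq_abs, abs_abs, ← mul_assoc]
    refine mul_le_mul_of_nonneg_right (abs_le.2 ⟨?_, ?_⟩) (hM_nonneg s) <;>
    nlinarith [sq_sub_le_mul_one_add_sq s (shat ℓ), sq_sub_le_mul_one_add_sq s (shat (ℓ + 1)),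
      sq_nonneg (s - shat ℓ), sq_nonneg (s - shat (ℓ + 1))]
  have hderiv := hasDerivAt_integral_mul_intervalIntegral hf_meas hf_nonneg hcont
    (w := fun s => (s - shat ℓ) ^ 2 - (s - shat (ℓ + 1)) ^ 2) (by fun_prop) hε hwM hfM
  have hlo : 1 < ℓ → t (ℓ - 1) < t ℓ := fun h => ht _ _ (by omega) (by omega) hℓ2
  have hhi : ℓ + 1 < L → t ℓ < t (ℓ + 1) := fun h => ht _ _ hℓ1 (by omega) (by omega)
  have hlocmin : IsLocalMin (fun u => ∫ s, ((s - shat ℓ) ^ 2 - (s - shat (ℓ + 1)) ^ 2) *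
      ∫ x in (t ℓ)..u, f s x) (t ℓ) := by
    have hlo' : ∀ᶠ u in nhds (t ℓ), 1 < ℓ → t (ℓ - 1) < u :=
      Filter.eventually_imp_distrib_left.2 fun h => eventually_gt_nhds (hlo h)
    have hhi' : ∀ᶠ u in nhds (t ℓ), ℓ + 1 < L → u < t (ℓ + 1) :=
      Filter.eventually_imp_distrib_left.2 fun h => eventually_lt_nhds (hhi h)
    filter_upwards [hlo', hhi'] with u hu hu'
    have hle := hmin _ (strictMono_update_threshold ht hu hu') shat
    rw [← sum_update_sub_sum hf_meas hf_nonneg hf_int shat t hℓ1 (by omega)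
      (fun h => ⟨hlo h, hu h⟩) (fun h => ⟨hhi h, hu' h⟩)]
    simpa using hle
  have hzero := hlocmin.hasDerivAt_eq_zero hderiv
  have hexpand : (fun s => ((s - shat ℓ) ^ 2 - (s - shat (ℓ + 1)) ^ 2) * f s (t ℓ)) =
      fun s => (shat (ℓ + 1) - shat ℓ) * (2 * (s * f s (t ℓ)) -
        (shat ℓ + shat (ℓ + 1)) * f s (t ℓ)) := by
    ext s
    ring
  rw [hexpand, integral_const_mul, integral_sub (hf1.const_mul _) (hf0.const_mul _),
    integral_const_mul, integral_const_mul] at hzero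
  have := (mul_eq_zero.1 hzero).resolve_left (sub_ne_zero.2 hne.symm)
  rw [eq_div_iff hfX.ne']
  linarith
end

section
/- (Lemma 3, necessary boundary condition for two-dimensional threshold-constrained indirect quantization.) Under the hypotheses and notation of the two-dimensional MSE derivative identity (joint density f of (S, X₁, X₂), identical thresholds −∞ = t₀ < t₁ < … < t_T < t_{T+1} = ∞ in both coordinates, reconstruction values ŝ_{i₁,i₂}, and the regularity hypotheses needed for the Leibniz rule), if the thresholds and reconstruction values minimize the MSE, then for each ℓ ∈ {1,…,T}: Σ_{i₁=1}^{T+1} ∫_ℝ [(s − ŝ_{i₁,ℓ})² − (s − ŝ_{i₁,ℓ+1})²] ∫_{t_{i₁−1}}^{t_{i₁}} f(s, x₁, t_ℓ) dx₁ ds + Σ_{i₂=1}^{T+1} ∫_ℝ [(s − ŝ_{ℓ,i₂})² − (s − ŝ_{ℓ+1,i₂})²] ∫_{t_{i₂−1}}^{t_{i₂}} f(s, t_ℓ, x₂) dx₂ ds = 0. -/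
open MeasureTheory

open Filter Topology Asymptotics

/-- The contribution to the MSE of a single product cell `A × B`, with weight `w` on the source. -/
noncomputable def cellMass (f : ℝ → ℝ → ℝ → ℝ) (w : ℝ → ℝ) (A B : Set ℝ) : ℝ :=
  ∫ p : ℝ × ℝ × ℝ, w p.1 * (A.indicator 1 p.2.1 * (B.indicator 1 p.2.2 * f p.1 p.2.1 p.2.2))

/-- The weighted mass of the slice `{x} × B`. -/
noncomputable def sliceMass (f : ℝ → ℝ → ℝ → ℝ) (w : ℝ → ℝ) (B : Set ℝ) (x : ℝ) : ℝ :=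
  ∫ q : ℝ × ℝ, w q.1 * (B.indicator 1 q.2 * f q.1 x q.2)

lemma abs_indicator_one_le (A : Set ℝ) (x : ℝ) : |A.indicator (1 : ℝ → ℝ) x| ≤ 1 := by
  by_cases h : x ∈ A <;> simp [h]

lemma abs_weight_mul_le {w C s k z m : ℝ} (hw : |w| ≤ C * (1 + s ^ 2)) (hk : |k| ≤ 1)
    (hz : 0 ≤ z) (hzm : z ≤ m) : |w * (k * z)| ≤ C * ((1 + s ^ 2) * m) := by
  rw [abs_mul, abs_mul, abs_of_nonneg hz, ← mul_assoc C]
  have hkz : |k| * z ≤ m := (mul_le_of_le_one_left hz hk).trans hzm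
  exact mul_le_mul hw hkz (by positivity) ((abs_nonneg _).trans hw)

lemma measurePreserving_prod_left_comm :
    MeasurePreserving (fun q : ℝ × ℝ × ℝ => (q.2.1, q.1, q.2.2)) volume volume := by
  have h1 : MeasurePreserving (MeasurableEquiv.prodAssoc : (ℝ × ℝ) × ℝ ≃ᵐ ℝ × ℝ × ℝ) :=
    volume_preserving_prodAssoc
  have h2 : MeasurePreserving (Prod.map Prod.swap id : (ℝ × ℝ) × ℝ → (ℝ × ℝ) × ℝ) :=
    (Measure.measurePreserving_swap (μ := (volume : Measure ℝ)) (ν := (volume : Measure ℝ))).prod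
      (MeasurePreserving.id volume)
  exact h1.comp (h2.comp (h1.symm _))

lemma measurePreserving_prod_right_comm :
    MeasurePreserving (fun q : ℝ × ℝ × ℝ => (q.1, q.2.2, q.2.1)) volume volume :=
  (MeasurePreserving.id (volume : Measure ℝ)).prod
    (Measure.measurePreserving_swap (μ := (volume : Measure ℝ)) (ν := (volume : Measure ℝ)))

section

variable {f : ℝ → ℝ → ℝ → ℝ} {w : ℝ → ℝ} {C : ℝ}

lemma measurable_swap_density (hf_meas : Measurable fun p : ℝ × ℝ × ℝ => f p.1 p.2.1 p.2.2) :
    Measurable fun p : ℝ × ℝ × ℝ => f p.1 p.2.2 p.2.1 :=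
  hf_meas.comp measurePreserving_prod_right_comm.measurable

lemma integrable_swap_density
    (hf_int : Integrable fun p : ℝ × ℝ × ℝ => (1 + p.1 ^ 2) * f p.1 p.2.1 p.2.2) :
    Integrable fun p : ℝ × ℝ × ℝ => (1 + p.1 ^ 2) * f p.1 p.2.2 p.2.1 :=
  measurePreserving_prod_right_comm.integrable_comp_of_integrable hf_int

lemma integrable_cellMass (hf_meas : Measurable fun p : ℝ × ℝ × ℝ => f p.1 p.2.1 p.2.2)
    (hf_nonneg : ∀ s x₁ x₂, 0 ≤ f s x₁ x₂)
    (hf_int : Integrable fun p : ℝ × ℝ × ℝ => (1 + p.1 ^ 2) * f p.1 p.2.1 p.2.2)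
    (hw : Measurable w) (hwC : ∀ s, |w s| ≤ C * (1 + s ^ 2))
    {A B : Set ℝ} (hA : MeasurableSet A) (hB : MeasurableSet B) :
    Integrable fun p : ℝ × ℝ × ℝ =>
      w p.1 * (A.indicator 1 p.2.1 * (B.indicator 1 p.2.2 * f p.1 p.2.1 p.2.2)) := by
  have hA' : Measurable (A.indicator (1 : ℝ → ℝ)) := measurable_one.indicator hA
  have hB' : Measurable (B.indicator (1 : ℝ → ℝ)) := measurable_one.indicator hB
  refine (hf_int.const_mul C).mono' (by fun_prop) (ae_of_all _ fun p => ?_)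
  rw [Real.norm_eq_abs, ← mul_assoc (A.indicator 1 p.2.1)]
  refine abs_weight_mul_le (hwC _) ?_ (hf_nonneg _ _ _) le_rfl
  rw [abs_mul]
  exact mul_le_one₀ (abs_indicator_one_le _ _) (abs_nonneg _) (abs_indicator_one_le _ _)

lemma cellMass_swap (f : ℝ → ℝ → ℝ → ℝ) (w : ℝ → ℝ) (A B : Set ℝ)
    (hint : Integrable fun p : ℝ × ℝ × ℝ =>
      w p.1 * (A.indicator 1 p.2.1 * (B.indicator 1 p.2.2 * f p.1 p.2.1 p.2.2))) :
    cellMass (fun s x y => f s y x) w B A = cellMass f w A B := by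
  unfold cellMass
  have h := measurePreserving_prod_right_comm
  rw [← h.map_eq] at hint
  have := integral_map (μ := (volume : Measure (ℝ × ℝ × ℝ))) h.aemeasurable
    hint.aestronglyMeasurable
  rw [h.map_eq] at this
  rw [this]
  refine integral_congr_ae (ae_of_all _ fun p => ?_)
  ring

lemma integrable_indicator_mul_sliceMass_and_integral
    (hf_meas : Measurable fun p : ℝ × ℝ × ℝ => f p.1 p.2.1 p.2.2)
    (hf_nonneg : ∀ s x₁ x₂, 0 ≤ f s x₁ x₂)
    (hf_int : Integrable fun p : ℝ × ℝ × ℝ => (1 + p.1 ^ 2) * f p.1 p.2.1 p.2.2)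
    (hw : Measurable w) (hwC : ∀ s, |w s| ≤ C * (1 + s ^ 2))
    {A B : Set ℝ} (hA : MeasurableSet A) (hB : MeasurableSet B) :
    Integrable (fun x => A.indicator 1 x * sliceMass f w B x) ∧
      ∫ x, A.indicator 1 x * sliceMass f w B x = cellMass f w A B := by
  have hint := integrable_cellMass hf_meas hf_nonneg hf_int hw hwC hA hB
  have h := measurePreserving_prod_left_comm
  have hint' := h.integrable_comp_of_integrable hint
  have heq : ∀ x, ∫ q : ℝ × ℝ,
      w q.1 * (A.indicator 1 x * (B.indicator 1 q.2 * f q.1 x q.2))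
        = A.indicator 1 x * sliceMass f w B x := fun x => by
    rw [sliceMass, ← integral_const_mul]
    exact integral_congr_ae (ae_of_all _ fun q => by ring)
  constructor
  · exact hint'.integral_prod_left.congr (ae_of_all _ heq)
  · have hmap := hint
    rw [← h.map_eq] at hmap
    have hcomp := integral_map (μ := (volume : Measure (ℝ × ℝ × ℝ))) h.aemeasurable
      hmap.aestronglyMeasurable
    rw [h.map_eq] at hcomp
    refine Eq.trans ?_ ((integral_prod _ hint').symm.trans hcomp.symm)
    exact integral_congr_ae (ae_of_all _ fun x => (heq x).symm)

lemma integrable_slice {M : ℝ → ℝ → ℝ}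
    (hf_meas : Measurable fun p : ℝ × ℝ × ℝ => f p.1 p.2.1 p.2.2)
    (hf_nonneg : ∀ s x₁ x₂, 0 ≤ f s x₁ x₂)
    (hM : Integrable fun p : ℝ × ℝ => (1 + p.1 ^ 2) * M p.1 p.2)
    (hw : Measurable w) (hwC : ∀ s, |w s| ≤ C * (1 + s ^ 2))
    {B : Set ℝ} (hB : MeasurableSet B) {x : ℝ} (hfM : ∀ s y, f s x y ≤ M s y) :
    Integrable fun q : ℝ × ℝ => w q.1 * (B.indicator 1 q.2 * f q.1 x q.2) := by
  have hB' : Measurable (B.indicator (1 : ℝ → ℝ)) := measurable_one.indicator hB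
  have hf' : Measurable fun q : ℝ × ℝ => f q.1 x q.2 :=
    hf_meas.comp (by fun_prop : Measurable fun q : ℝ × ℝ => (q.1, x, q.2))
  refine (hM.const_mul C).mono' (by fun_prop) (ae_of_all _ fun q => ?_)
  exact abs_weight_mul_le (hwC _) (abs_indicator_one_le _ _) (hf_nonneg _ _ _) (hfM _ _)

lemma tendsto_sliceMass {M : ℝ → ℝ → ℝ} {a ε : ℝ} {B : ℝ → Set ℝ}
    (hf_meas : Measurable fun p : ℝ × ℝ × ℝ => f p.1 p.2.1 p.2.2)
    (hf_nonneg : ∀ s x₁ x₂, 0 ≤ f s x₁ x₂)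
    (hcont : ∀ s y, Continuous fun x => f s x y)
    (hM : Integrable fun p : ℝ × ℝ => (1 + p.1 ^ 2) * M p.1 p.2) (hε : 0 < ε)
    (hfM : ∀ s x y, |x - a| < ε → f s x y ≤ M s y)
    (hw : Measurable w) (hwC : ∀ s, |w s| ≤ C * (1 + s ^ 2))
    (hB : ∀ u, MeasurableSet (B u))
    (hBa : ∀ y, y ≠ a → ∀ᶠ u in 𝓝 a, (y ∈ B u ↔ y ∈ B a)) :
    Tendsto (fun p : ℝ × ℝ => sliceMass f w (B p.2) p.1) (𝓝 (a, a))
      (𝓝 (sliceMass f w (B a) a)) := by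
  have hnear : ∀ᶠ p : ℝ × ℝ in 𝓝 (a, a), |p.1 - a| < ε :=
    (continuous_fst.tendsto (a, a)).eventually (eventually_abs_sub_lt a hε)
  refine tendsto_integral_filter_of_dominated_convergence
    (fun q => C * ((1 + q.1 ^ 2) * M q.1 q.2)) ?_ ?_ (hM.const_mul C) ?_
  · filter_upwards [hnear] with p hp
    exact (integrable_slice hf_meas hf_nonneg hM hw hwC (hB _)
      fun s y => hfM s p.1 y hp).aestronglyMeasurable
  · filter_upwards [hnear] with p hp
    exact ae_of_all _ fun q => abs_weight_mul_le (hwC _) (abs_indicator_one_le _ _)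
      (hf_nonneg _ _ _) (hfM _ _ _ hp)
  · have hne : ∀ᵐ q : ℝ × ℝ, q.2 ≠ a :=
      (Measure.quasiMeasurePreserving_snd (μ := (volume : Measure ℝ))
        (ν := (volume : Measure ℝ))).ae (Measure.ae_ne volume a)
    filter_upwards [hne] with q hq
    refine Tendsto.const_mul _ (Tendsto.mul ?_ ?_)
    · refine tendsto_const_nhds.congr' ?_
      filter_upwards [(continuous_snd.tendsto (a, a)).eventually (hBa _ hq)] with p hp
      by_cases h : q.2 ∈ B a
      · simp [h, hp.2 h]
      · simp [h, mt hp.1 h]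
    · exact ((hcont q.1 q.2).tendsto a).comp (continuous_fst.tendsto (a, a))

/-- A family of sets whose right (`σ = 1`), left (`σ = -1`) or no (`σ = 0`) endpoint moves
with the parameter, near the parameter value `a`. -/
structure IsMovingCell (A : ℝ → Set ℝ) (a σ : ℝ) : Prop where
  measurableSet : ∀ u, MeasurableSet (A u)
  indicator_sub : ∀ᶠ u in 𝓝 a, ∀ x, (A u).indicator (1 : ℝ → ℝ) x - (A a).indicator 1 x
    = σ * ((Set.Ioc a u).indicator 1 x - (Set.Ioc u a).indicator 1 x)

lemma IsMovingCell.eventually_mem_iff {A : ℝ → Set ℝ} {a σ : ℝ} (hA : IsMovingCell A a σ)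
    {x : ℝ} (hx : x ≠ a) : ∀ᶠ u in 𝓝 a, (x ∈ A u ↔ x ∈ A a) := by
  have hu : ∀ᶠ u in 𝓝 a, |u - a| < |x - a| :=
    eventually_abs_sub_lt a (abs_pos.2 (sub_ne_zero.2 hx))
  filter_upwards [hA.indicator_sub, hu] with u h hu
  have h1 : x ∉ Set.Ioc a u := fun h' => by
    rw [abs_of_pos (sub_pos.2 h'.1)] at hu
    linarith [(abs_lt.1 hu).2, h'.2]
  have h2 : x ∉ Set.Ioc u a := fun h' => by
    rw [abs_of_nonpos (sub_nonpos.2 h'.2)] at hu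
    linarith [(abs_lt.1 hu).1, h'.1]
  have h := h x
  by_cases hxu : x ∈ A u <;> by_cases hxa : x ∈ A a <;> simp_all

lemma cellMass_sub_isLittleO {M : ℝ → ℝ → ℝ} {a ε σ : ℝ} {A B : ℝ → Set ℝ}
    (hf_meas : Measurable fun p : ℝ × ℝ × ℝ => f p.1 p.2.1 p.2.2)
    (hf_nonneg : ∀ s x₁ x₂, 0 ≤ f s x₁ x₂)
    (hf_int : Integrable fun p : ℝ × ℝ × ℝ => (1 + p.1 ^ 2) * f p.1 p.2.1 p.2.2)
    (hcont : ∀ s y, Continuous fun x => f s x y)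
    (hM : Integrable fun p : ℝ × ℝ => (1 + p.1 ^ 2) * M p.1 p.2) (hε : 0 < ε)
    (hfM : ∀ s x y, |x - a| < ε → f s x y ≤ M s y)
    (hw : Measurable w) (hwC : ∀ s, |w s| ≤ C * (1 + s ^ 2))
    (hA : IsMovingCell A a σ) (hB : ∀ u, MeasurableSet (B u))
    (hBa : ∀ y, y ≠ a → ∀ᶠ u in 𝓝 a, (y ∈ B u ↔ y ∈ B a)) :
    (fun u => cellMass f w (A u) (B u) - cellMass f w (A a) (B u)
      - σ * sliceMass f w (B a) a * (u - a)) =o[𝓝 a] fun u => u - a := by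
  have hdiff : ∀ᶠ u in 𝓝 a, cellMass f w (A u) (B u) - cellMass f w (A a) (B u)
      = σ * ∫ x in a..u, sliceMass f w (B u) x := by
    filter_upwards [hA.indicator_sub] with u hu
    have key : ∀ {D : Set ℝ}, MeasurableSet D → _ := fun {D} hD =>
      integrable_indicator_mul_sliceMass_and_integral (A := D) hf_meas hf_nonneg hf_int hw hwC
        hD (hB u)
    have hset : ∀ {D : Set ℝ}, MeasurableSet D →
        ∫ x in D, sliceMass f w (B u) x = ∫ x, D.indicator 1 x * sliceMass f w (B u) x := by
      intro D hD
      rw [← integral_indicator hD]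
      refine integral_congr_ae (ae_of_all _ fun x => ?_)
      by_cases h : x ∈ D <;> simp [h]
    rw [← (key (hA.measurableSet u)).2, ← (key (hA.measurableSet a)).2,
      ← integral_sub (key (hA.measurableSet u)).1 (key (hA.measurableSet a)).1,
      intervalIntegral, hset measurableSet_Ioc, hset measurableSet_Ioc,
      ← integral_sub (key measurableSet_Ioc).1 (key measurableSet_Ioc).1, ← integral_const_mul]
    refine integral_congr_ae (ae_of_all _ fun x => ?_)
    simp only [← sub_mul, hu x]
    ring
  have hloc : ∀ u, IntervalIntegrable (fun x => sliceMass f w (B u) x) volume a u := fun u => by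
    have := (integrable_indicator_mul_sliceMass_and_integral (A := Set.univ) hf_meas hf_nonneg
      hf_int hw hwC MeasurableSet.univ (hB u)).1
    simp only [Set.indicator_univ, Pi.one_apply, one_mul] at this
    exact this.intervalIntegrable
  have hmain : (fun u => (∫ x in a..u, sliceMass f w (B u) x)
      - sliceMass f w (B a) a * (u - a)) =o[𝓝 a] fun u => u - a := by
    rw [Asymptotics.isLittleO_iff]
    intro c hc
    have ht := tendsto_sliceMass hf_meas hf_nonneg hcont hM hε hfM hw hwC hB hBa
    have hev := Metric.tendsto_nhds.1 ht c hc
    obtain ⟨δ, hδ, hball⟩ := Metric.eventually_nhds_iff.1 hev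
    filter_upwards [Metric.ball_mem_nhds a hδ] with u hu
    have hconst : sliceMass f w (B a) a * (u - a) = ∫ _ in a..u, sliceMass f w (B a) a := by
      rw [intervalIntegral.integral_const, smul_eq_mul, mul_comm]
    rw [hconst, ← intervalIntegral.integral_sub (hloc u) intervalIntegrable_const]
    refine intervalIntegral.norm_integral_le_of_norm_le_const fun x hx => ?_
    have hxa : |x - a| ≤ |u - a| := Set.abs_sub_left_of_mem_uIcc (Set.uIoc_subset_uIcc hx)
    have := @hball (x, u) (by
      rw [Prod.dist_eq, max_lt_iff]
      exact ⟨hxa.trans_lt hu, hu⟩)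
    exact this.le
  refine (hmain.const_mul_left σ).congr' ?_ Filter.EventuallyEq.rfl
  filter_upwards [hdiff] with u hu
  rw [hu]
  ring

lemma hasDerivAt_cellMass {M : ℝ → ℝ → ℝ} {a ε σ τ : ℝ} {A B : ℝ → Set ℝ}
    (hf_meas : Measurable fun p : ℝ × ℝ × ℝ => f p.1 p.2.1 p.2.2)
    (hf_nonneg : ∀ s x₁ x₂, 0 ≤ f s x₁ x₂)
    (hf_int : Integrable fun p : ℝ × ℝ × ℝ => (1 + p.1 ^ 2) * f p.1 p.2.1 p.2.2)
    (hcont : ∀ s, Continuous fun p : ℝ × ℝ => f s p.1 p.2)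
    (hM : Integrable fun p : ℝ × ℝ => (1 + p.1 ^ 2) * M p.1 p.2) (hε : 0 < ε)
    (hfM : ∀ s x y, |y - a| < ε → f s x y ≤ M s x ∧ f s y x ≤ M s x)
    (hw : Measurable w) (hwC : ∀ s, |w s| ≤ C * (1 + s ^ 2))
    (hA : IsMovingCell A a σ) (hB : IsMovingCell B a τ) :
    HasDerivAt (fun u => cellMass f w (A u) (B u))
      (σ * sliceMass f w (B a) a + τ * sliceMass (fun s x y => f s y x) w (A a) a) a := by
  have h1 := cellMass_sub_isLittleO hf_meas hf_nonneg hf_int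
    (fun s y => (hcont s).comp (by fun_prop : Continuous fun x : ℝ => (x, y))) hM hε
    (fun s x y h => (hfM s y x h).2) hw hwC hA hB.measurableSet fun y hy => hB.eventually_mem_iff hy
  have h2 := cellMass_sub_isLittleO (f := fun s x y => f s y x) (B := fun _ => A a)
    (measurable_swap_density hf_meas) (fun s x y => hf_nonneg s y x)
    (integrable_swap_density hf_int)
    (fun s y => (hcont s).comp (by fun_prop : Continuous fun x : ℝ => (y, x))) hM hε
    (fun s x y h => (hfM s y x h).1) hw hwC hB (fun _ => hA.measurableSet a) (by simp)
  rw [hasDerivAt_iff_isLittleO]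
  refine (h1.add h2).congr_left fun u => ?_
  simp only [smul_eq_mul]
  have hint := fun v => integrable_cellMass hf_meas hf_nonneg hf_int hw hwC (hA.measurableSet a)
    (hB.measurableSet v)
  rw [cellMass_swap f w _ _ (hint u), cellMass_swap f w _ _ (hint a)]
  ring

lemma integral_mul_setIntegral_eq_cellMass
    (hf_meas : Measurable fun p : ℝ × ℝ × ℝ => f p.1 p.2.1 p.2.2)
    (hf_nonneg : ∀ s x₁ x₂, 0 ≤ f s x₁ x₂)
    (hf_int : Integrable fun p : ℝ × ℝ × ℝ => (1 + p.1 ^ 2) * f p.1 p.2.1 p.2.2)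
    (hw : Measurable w) (hwC : ∀ s, |w s| ≤ C * (1 + s ^ 2))
    {A B : Set ℝ} (hA : MeasurableSet A) (hB : MeasurableSet B) :
    ∫ s, w s * ∫ x₁ in A, ∫ x₂ in B, f s x₁ x₂ = cellMass f w A B := by
  rw [cellMass, Measure.volume_eq_prod,
    integral_prod _ (integrable_cellMass hf_meas hf_nonneg hf_int hw hwC hA hB)]
  refine integral_congr_ae ?_
  filter_upwards [hf_int.prod_right_ae] with s hs
  have hfs : Integrable fun p : ℝ × ℝ => f s p.1 p.2 := by
    refine (hs.const_mul (1 + s ^ 2)⁻¹).congr (ae_of_all _ fun p => ?_)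
    have : (1 + s ^ 2) ≠ 0 := by positivity
    field_simp
  simp only [integral_const_mul]
  congr 1
  rw [← setIntegral_prod (fun p : ℝ × ℝ => f s p.1 p.2) hfs.integrableOn,
    ← integral_indicator (hA.prod hB)]
  refine integral_congr_ae (ae_of_all _ fun p => ?_)
  by_cases h1 : p.1 ∈ A <;> by_cases h2 : p.2 ∈ B <;> simp [Set.indicator, h1, h2]

lemma sliceMass_eq_integral_integral {M : ℝ → ℝ → ℝ} {x : ℝ}
    (hf_meas : Measurable fun p : ℝ × ℝ × ℝ => f p.1 p.2.1 p.2.2)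
    (hf_nonneg : ∀ s x₁ x₂, 0 ≤ f s x₁ x₂)
    (hM : Integrable fun p : ℝ × ℝ => (1 + p.1 ^ 2) * M p.1 p.2)
    (hfM : ∀ s y, f s x y ≤ M s y)
    (hw : Measurable w) (hwC : ∀ s, |w s| ≤ C * (1 + s ^ 2))
    {B : Set ℝ} (hB : MeasurableSet B) :
    Integrable (fun s => w s * ∫ y in B, f s x y) ∧
      sliceMass f w B x = ∫ s, w s * ∫ y in B, f s x y := by
  have hint := integrable_slice hf_meas hf_nonneg hM hw hwC hB hfM
  have heq : ∀ s, ∫ y, w s * (B.indicator 1 y * f s x y) = w s * ∫ y in B, f s x y := fun s => by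
    rw [integral_const_mul, ← integral_indicator hB]
    congr 2 with y
    by_cases h : y ∈ B <;> simp [h]
  refine ⟨hint.integral_prod_left.congr (ae_of_all _ heq), ?_⟩
  rw [sliceMass, Measure.volume_eq_prod, integral_prod _ hint]
  exact integral_congr_ae (ae_of_all _ heq)

end

lemma measurableSet_cell (L : ℕ) (t : ℕ → ℝ) (j : ℕ) : MeasurableSet (cell L t j) :=
  ((MeasurableSet.const (1 < j)).imp measurableSet_Ioi).inter
    ((MeasurableSet.const (j < L)).imp measurableSet_Iic)

lemma abs_sub_sq_le (c s : ℝ) : |(s - c) ^ 2| ≤ (2 + 2 * c ^ 2) * (1 + s ^ 2) := by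
  rw [abs_of_nonneg (sq_nonneg _)]
  nlinarith [sq_nonneg (s + c), mul_nonneg (sq_nonneg s) (sq_nonneg c)]

lemma eventually_update_strictMono {T ℓ : ℕ} {t : ℕ → ℝ}
    (ht : ∀ i j : ℕ, 1 ≤ i → i < j → j ≤ T → t i < t j) (hℓ1 : 1 ≤ ℓ) (hℓ2 : ℓ ≤ T) :
    ∀ᶠ u in 𝓝 (t ℓ), ∀ i j : ℕ, 1 ≤ i → i < j → j ≤ T →
      Function.update t ℓ u i < Function.update t ℓ u j := by
  have hlo : ∀ᶠ u in 𝓝 (t ℓ), ∀ i ∈ Finset.Ico 1 ℓ, t i < u :=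
    (Finset.eventually_all _).2 fun i hi =>
      lt_mem_nhds (ht i ℓ (Finset.mem_Ico.1 hi).1 (Finset.mem_Ico.1 hi).2 hℓ2)
  have hhi : ∀ᶠ u in 𝓝 (t ℓ), ∀ j ∈ Finset.Ioc ℓ T, u < t j :=
    (Finset.eventually_all _).2 fun j hj =>
      gt_mem_nhds (ht ℓ j hℓ1 (Finset.mem_Ioc.1 hj).1 (Finset.mem_Ioc.1 hj).2)
  filter_upwards [hlo, hhi] with u hlo hhi i j hi hij hj
  rcases eq_or_ne i ℓ with rfl | hiℓ
  · rw [Function.update_self, Function.update_of_ne hij.ne']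
    exact hhi j (Finset.mem_Ioc.2 ⟨hij, hj⟩)
  · rcases eq_or_ne j ℓ with rfl | hjℓ
    · rw [Function.update_self, Function.update_of_ne hiℓ]
      exact hlo i (Finset.mem_Ico.2 ⟨hi, hij⟩)
    · rw [Function.update_of_ne hiℓ, Function.update_of_ne hjℓ]
      exact ht i j hi hij hj

/-- The orientation of the boundary point `t ℓ` with respect to cell `i`. -/
def boundarySign (ℓ i : ℕ) : ℝ := (if i = ℓ then 1 else 0) - (if i = ℓ + 1 then 1 else 0)

lemma sum_boundarySign_mul {T ℓ : ℕ} (hℓ1 : 1 ≤ ℓ) (hℓ2 : ℓ ≤ T) (g : ℕ → ℝ) :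
    ∑ i ∈ Finset.Icc 1 (T + 1), boundarySign ℓ i * g i = g ℓ - g (ℓ + 1) := by
  simp only [boundarySign, sub_mul, ite_mul, one_mul, zero_mul, Finset.sum_sub_distrib,
    Finset.sum_ite_eq', Finset.mem_Icc]
  rw [if_pos ⟨hℓ1, by omega⟩, if_pos ⟨by omega, by omega⟩]

lemma isMovingCell_cell {T ℓ : ℕ} {t : ℕ → ℝ}
    (ht : ∀ i j : ℕ, 1 ≤ i → i < j → j ≤ T → t i < t j) (hℓ1 : 1 ≤ ℓ) (hℓ2 : ℓ ≤ T) (i : ℕ) :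
    IsMovingCell (fun u => cell (T + 1) (Function.update t ℓ u) i) (t ℓ) (boundarySign ℓ i) := by
  refine ⟨fun u => measurableSet_cell _ _ _, ?_⟩
  filter_upwards [eventually_update_strictMono ht hℓ1 hℓ2] with u hu x
  simp only [Function.update_eq_self]
  rcases eq_or_ne i ℓ with rfl | hi
  · have hne : i - 1 ≠ i := by omega
    have h1 : 1 < i → t (i - 1) < t i := fun h => ht _ _ (by omega) (by omega) hℓ2
    have h2 : 1 < i → t (i - 1) < u := fun h => by
      have := hu (i - 1) i (by omega) (by omega) hℓ2
      rwa [Function.update_self, Function.update_of_ne hne] at this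
    have h3 : i < T + 1 := by omega
    by_cases h : 1 < i
    · have h1 := h1 h
      have h2 := h2 h
      simp only [cell, boundarySign, Set.indicator, Set.mem_ofPred_eq, Function.update_self,
        Function.update_of_ne hne, h, h3, Set.mem_Ioc, Pi.one_apply]
      grind
    · simp only [cell, boundarySign, Set.indicator, Set.mem_ofPred_eq, Function.update_self,
        h, h3, Set.mem_Ioc, Pi.one_apply]
      grind
  · rcases eq_or_ne i (ℓ + 1) with rfl | hi'
    · have h3 : 1 < ℓ + 1 := by omega
      by_cases h : ℓ + 1 < T + 1
      · have h1 := ht ℓ (ℓ + 1) hℓ1 (by omega) (by omega)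
        have h2 := hu ℓ (ℓ + 1) hℓ1 (by omega) (by omega)
        rw [Function.update_self, Function.update_of_ne hi] at h2
        simp only [cell, boundarySign, Set.indicator, Set.mem_ofPred_eq, Function.update_self,
          Function.update_of_ne hi, Nat.add_sub_cancel, h, h3, Set.mem_Ioc, Pi.one_apply]
        grind
      · simp only [cell, boundarySign, Set.indicator, Set.mem_ofPred_eq, Function.update_self,
          Nat.add_sub_cancel, h, h3, Set.mem_Ioc, Pi.one_apply]
        grind
    · have hi'' : i - 1 ≠ ℓ := by omega
      simp [cell, boundarySign, Function.update_of_ne hi'', hi, hi']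

/-- **Lemma 3: necessary boundary condition for two-dimensional
threshold-constrained indirect quantization.**  Under the hypotheses of the two-dimensional
MSE derivative identity (joint density `f` of `(S,X₁,X₂)`, identical thresholds
`−∞ = t₀ < t₁ < … < t_T < t_{T+1} = ∞` in both coordinates, reconstruction values `ŝ_{i₁,i₂}`,
and the Leibniz-rule regularity hypotheses), if the thresholds and reconstruction values
minimize the MSE, then for each `ℓ ∈ {1,…,T}`:
`Σ_{i₁} ∫_ℝ [(s − ŝ_{i₁,ℓ})² − (s − ŝ_{i₁,ℓ+1})²] ∫_{cell i₁} f(s,x₁,t_ℓ) dx₁ ds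
 + Σ_{i₂} ∫_ℝ [(s − ŝ_{ℓ,i₂})² − (s − ŝ_{ℓ+1,i₂})²] ∫_{cell i₂} f(s,t_ℓ,x₂) dx₂ ds = 0`. -/
theorem stmt_14 (T : ℕ) (hT : 1 ≤ T) (f : ℝ → ℝ → ℝ → ℝ)
    (hf_meas : Measurable (fun p : ℝ × ℝ × ℝ => f p.1 p.2.1 p.2.2))
    (hf_nonneg : ∀ s x₁ x₂, 0 ≤ f s x₁ x₂)
    (hf_int : Integrable (fun p : ℝ × ℝ × ℝ => (1 + p.1 ^ 2) * f p.1 p.2.1 p.2.2))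
    (hcont : ∀ s, Continuous (fun p : ℝ × ℝ => f s p.1 p.2))
    (shat : ℕ → ℕ → ℝ) (t : ℕ → ℝ)
    (ht : ∀ i j : ℕ, 1 ≤ i → i < j → j ≤ T → t i < t j)
    (hdom : ∀ j : ℕ, 1 ≤ j → j ≤ T → ∃ ε > (0 : ℝ), ∃ M : ℝ → ℝ → ℝ,
      Integrable (fun p : ℝ × ℝ => (1 + p.1 ^ 2) * M p.1 p.2) ∧
      ∀ s x y, |y - t j| < ε → f s x y ≤ M s x ∧ f s y x ≤ M s x)
    (hmin : ∀ (t' : ℕ → ℝ), (∀ i j : ℕ, 1 ≤ i → i < j → j ≤ T → t' i < t' j) →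
      ∀ shat' : ℕ → ℕ → ℝ,
      (∑ i₁ ∈ Finset.Icc 1 (T + 1), ∑ i₂ ∈ Finset.Icc 1 (T + 1),
        ∫ s, (s - shat i₁ i₂) ^ 2 *
          ∫ x₁ in cell (T + 1) t i₁, ∫ x₂ in cell (T + 1) t i₂, f s x₁ x₂)
        ≤ ∑ i₁ ∈ Finset.Icc 1 (T + 1), ∑ i₂ ∈ Finset.Icc 1 (T + 1),
            ∫ s, (s - shat' i₁ i₂) ^ 2 *
              ∫ x₁ in cell (T + 1) t' i₁, ∫ x₂ in cell (T + 1) t' i₂, f s x₁ x₂)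
    (ℓ : ℕ) (hℓ1 : 1 ≤ ℓ) (hℓ2 : ℓ ≤ T) :
    (∑ i₁ ∈ Finset.Icc 1 (T + 1),
        ∫ s, ((s - shat i₁ ℓ) ^ 2 - (s - shat i₁ (ℓ + 1)) ^ 2) *
          ∫ x₁ in cell (T + 1) t i₁, f s x₁ (t ℓ))
      + (∑ i₂ ∈ Finset.Icc 1 (T + 1),
          ∫ s, ((s - shat ℓ i₂) ^ 2 - (s - shat (ℓ + 1) i₂) ^ 2) *
            ∫ x₂ in cell (T + 1) t i₂, f s (t ℓ) x₂) = 0 := by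
  obtain ⟨ε, hε, M, hM, hfM⟩ := hdom ℓ hℓ1 hℓ2
  have hw : ∀ c : ℝ, Measurable fun s : ℝ => (s - c) ^ 2 := fun c => by fun_prop
  have hcell := isMovingCell_cell ht hℓ1 hℓ2
  have hderiv := HasDerivAt.fun_sum (u := Finset.Icc 1 (T + 1)) fun i _ =>
    HasDerivAt.fun_sum (u := Finset.Icc 1 (T + 1)) fun j _ =>
      hasDerivAt_cellMass hf_meas hf_nonneg hf_int hcont hM hε hfM (hw (shat i j))
        (abs_sub_sq_le _) (hcell i) (hcell j)
  have hlocmin : IsLocalMin (fun u => ∑ i ∈ Finset.Icc 1 (T + 1), ∑ j ∈ Finset.Icc 1 (T + 1),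
      cellMass f (fun s => (s - shat i j) ^ 2) (cell (T + 1) (Function.update t ℓ u) i)
        (cell (T + 1) (Function.update t ℓ u) j)) (t ℓ) := by
    filter_upwards [eventually_update_strictMono ht hℓ1 hℓ2] with u hu
    have h := hmin _ hu shat
    simp only [integral_mul_setIntegral_eq_cellMass hf_meas hf_nonneg hf_int (hw _)
      (abs_sub_sq_le _) (measurableSet_cell _ _ _) (measurableSet_cell _ _ _)] at h
    simpa only [Function.update_eq_self] using h
  have hzero := hlocmin.hasDerivAt_eq_zero hderiv
  simp only [Function.update_eq_self, Finset.sum_add_distrib] at hzero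
  rw [Finset.sum_comm] at hzero
  simp only [sum_boundarySign_mul hℓ1 hℓ2] at hzero
  have hself : |t ℓ - t ℓ| < ε := by simpa using hε
  have hX := fun c j => sliceMass_eq_integral_integral hf_meas hf_nonneg hM
    (fun s y => (hfM s y (t ℓ) hself).2) (hw c) (abs_sub_sq_le c) (measurableSet_cell (T + 1) t j)
  have hY := fun c j => sliceMass_eq_integral_integral (f := fun s x y => f s y x)
    (measurable_swap_density hf_meas) (fun s x y => hf_nonneg s y x) hM
    (fun s y => (hfM s y (t ℓ) hself).1) (hw c) (abs_sub_sq_le c) (measurableSet_cell (T + 1) t j)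
  rw [← hzero, add_comm]
  congr 1 <;> refine Finset.sum_congr rfl fun i _ => ?_
  · rw [(hX _ _).2, (hX _ _).2, ← integral_sub (hX _ _).1 (hX _ _).1]
    simp only [sub_mul]
  · rw [(hY _ _).2, (hY _ _).2, ← integral_sub (hY _ _).1 (hY _ _).1]
    simp only [sub_mul]
end
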